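/- A generalized weight 𝕀_n-module M is finitely generated if and only if its support is contained in a union of finitely many ℤ^n-orbits in K^n and the dimensions of all its generalized weight components are bounded by a natural number (sup_{λ} dim_K M^λ < ∞). -/

import Mathlib

set_option maxHeartbeats 1000000
set_option synthInstance.maxHeartbeats 400000
set_option linter.unusedSectionVars false

namespace IDO

open scoped TensorProduct

noncomputable section

variable (K : Type*) [Field K] [CharZero K] (n : ℕ)

/-- The polynomial algebra `P_n = K[x_1, …, x_n]`. -/
abbrev P := MvPolynomial (Fin n) K

/-- The multiplication operator `x_i`. -/
def xOp (i : Fin n) : Module.End K (P K n) := LinearMap.mulLeft K (MvPolynomial.X i)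

/-- The partial derivative `∂_i`. -/
def dOp (i : Fin n) : Module.End K (P K n) := (MvPolynomial.pderiv i).toLinearMap

/-- The integration operator `∫_i`, sending `x^α ↦ x^{α+e_i}/(α_i+1)`. -/
def intOp (i : Fin n) : Module.End K (P K n) :=
  ((MvPolynomial.basisMonomials (Fin n) K).constr K)
    (fun α => (((α i : ℕ) : K) + 1)⁻¹ •
      (MvPolynomial.monomial (α + Finsupp.single i 1) (1 : K)))

/-- The algebra of polynomial integro-differential operators `𝕀_n`, as a subalgebra of
`End_K(P_n)` generated by the `x_i`, `∂_i` and `∫_i`. -/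
def InSub : Subalgebra K (Module.End K (P K n)) :=
  Algebra.adjoin K (Set.range (xOp K n) ∪ Set.range (dOp K n) ∪ Set.range (intOp K n))

/-- The algebra `𝕀_n` (as a type, with its canonical ring structure). -/
def In : Type _ := InSub K n

instance : Ring (In K n) := inferInstanceAs (Ring (InSub K n))
instance : Algebra K (In K n) := inferInstanceAs (Algebra K (InSub K n))
instance : Module (In K n) (P K n) := inferInstanceAs (Module (InSub K n) (P K n))
instance : IsScalarTower K (In K n) (P K n) :=
  inferInstanceAs (IsScalarTower K (InSub K n) (P K n))

/-- `x_i` as an element of `𝕀_n`. -/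
def xEl (i : Fin n) : In K n :=
  show InSub K n from
    ⟨xOp K n i, Algebra.subset_adjoin (Set.mem_union_left _ (Set.mem_union_left _ ⟨i, rfl⟩))⟩

/-- `∂_i` as an element of `𝕀_n`. -/
def dEl (i : Fin n) : In K n :=
  show InSub K n from
    ⟨dOp K n i, Algebra.subset_adjoin (Set.mem_union_left _ (Set.mem_union_right _ ⟨i, rfl⟩))⟩

/-- `∫_i` as an element of `𝕀_n`. -/
def intEl (i : Fin n) : In K n :=
  show InSub K n from
    ⟨intOp K n i, Algebra.subset_adjoin (Set.mem_union_right _ ⟨i, rfl⟩)⟩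

/-- `H_i = ∂_i x_i` as an element of `𝕀_n`. -/
def HEl (i : Fin n) : In K n := dEl K n i * xEl K n i

section Modules

variable (M : Type*) [AddCommGroup M] [Module K M] [Module (In K n) M]
  [IsScalarTower K (In K n) M]

/-- The weight space `M_λ = {m | H_i m = λ_i m for all i}`. -/
def weightSpace (lam : Fin n → K) : Submodule K M where
  carrier := {m | ∀ i, HEl K n i • m = lam i • m}
  add_mem' := by
    intro a b ha hb i
    rw [smul_add, ha i, hb i, smul_add]
  zero_mem' := by intro i; simp
  smul_mem' := by
    intro c m hm i
    rw [← smul_comm c (HEl K n i) m, hm i, smul_smul, mul_comm, ← smul_smul]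

private lemma pow_smul_zero_mono {a : In K n} {m : M} {s s' : ℕ}
    (h : (a ^ s) • m = 0) (hle : s ≤ s') : (a ^ s') • m = 0 := by
  obtain ⟨k, rfl⟩ := Nat.exists_eq_add_of_le hle
  rw [add_comm s k, pow_add, mul_smul, h, smul_zero]

/-- The generalized weight space `M^λ = {m | (H_i − λ_i)^N m = 0 for some N and all i}`. -/
def genWeightSpace (lam : Fin n → K) : Submodule K M where
  carrier := {m | ∃ N : ℕ, ∀ i,
    ((HEl K n i - algebraMap K (In K n) (lam i)) ^ N) • m = 0}
  add_mem' := by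
    rintro a b ⟨Na, ha⟩ ⟨Nb, hb⟩
    refine ⟨Na ⊔ Nb, fun i => ?_⟩
    rw [smul_add, pow_smul_zero_mono K n M (ha i) le_sup_left,
      pow_smul_zero_mono K n M (hb i) le_sup_right, add_zero]
  zero_mem' := ⟨0, fun i => smul_zero _⟩
  smul_mem' := by
    rintro c m ⟨N, hN⟩
    exact ⟨N, fun i => by rw [← smul_comm c _ m, hN i, smul_zero]⟩

/-- `M` is a weight module: `M = ⊕_λ M_λ`. -/
def IsWeightModule : Prop :=
  letI := Classical.decEq (Fin n → K)
  DirectSum.IsInternal (fun lam : Fin n → K => weightSpace K n M lam)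

/-- `M` is a generalized weight module: `M = ⊕_λ M^λ`. -/
def IsGenWeightModule : Prop :=
  letI := Classical.decEq (Fin n → K)
  DirectSum.IsInternal (fun lam : Fin n → K => genWeightSpace K n M lam)

/-- The support `Supp(M) = {λ | M^λ ≠ 0}`. -/
def supp : Set (Fin n → K) := {lam | genWeightSpace K n M lam ≠ ⊥}

/-- `M` is an indecomposable `𝕀_n`-module. -/
def IsIndecomposableMod : Prop :=
  Nontrivial M ∧ ∀ p q : Submodule (In K n) M, IsCompl p q → p = ⊥ ∨ q = ⊥

/-- The annihilator of an `𝕀_n`-module, as a set. -/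
def annSet : Set (In K n) := {a | ∀ m : M, a • m = 0}

end Modules

/-- A prime (two-sided) ideal of the noncommutative ring `𝕀_n`, given as a set:
`S ≠ 𝕀_n` and `a 𝕀_n b ⊆ S → a ∈ S ∨ b ∈ S`. -/
def IsPrimeSet (S : Set (In K n)) : Prop :=
  S ≠ Set.univ ∧ ∀ a b : In K n, (∀ r : In K n, a * r * b ∈ S) → a ∈ S ∨ b ∈ S

-- orbits
/-- The `ℤ^n`-orbit of `λ ∈ K^n`. -/
def orbitOf (lam : Fin n → K) : Set (Fin n → K) :=
  {mu | ∀ i, ∃ z : ℤ, mu i - lam i = (z : K)}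

/-- The setoid on `K^n` whose classes are the `ℤ^n`-orbits. -/
def orbitSetoid : Setoid (Fin n → K) where
  r mu nu := ∀ i, ∃ z : ℤ, mu i - nu i = (z : K)
  iseqv := by
    constructor
    · intro x i; exact ⟨0, by simp⟩
    · intro x y h i
      obtain ⟨z, hz⟩ := h i
      exact ⟨-z, by push_cast; linear_combination -hz⟩
    · intro x y z hxy hyz i
      obtain ⟨a, ha⟩ := hxy i
      obtain ⟨b, hb⟩ := hyz i
      exact ⟨a + b, by push_cast; linear_combination ha + hb⟩

/-- `𝔻_Ω = {i | Ω_i = ℤ}` for the orbit `Ω` of `λ`. -/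
def DD (lam : Fin n → K) : Set (Fin n) := {i | ∃ z : ℤ, lam i = (z : K)}

/-- `λ` is the normalized representative of its orbit: integer coordinates are `0`. -/
def IsNormalized (lam : Fin n → K) : Prop := ∀ i, (∃ z : ℤ, lam i = (z : K)) → lam i = 0


-- I_1 specifics
/-- The matrix units `e_{st} = ∫^s ∂^t − ∫^{s+1} ∂^{t+1}` of `𝕀_1`. -/
def eEl1 (s t : ℕ) : In K 1 :=
  intEl K 1 0 ^ s * dEl K 1 0 ^ t - intEl K 1 0 ^ (s + 1) * dEl K 1 0 ^ (t + 1)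

/-- `F = ⊕ K e_{st}`, the unique proper two-sided ideal of `𝕀_1`, here as the left ideal
generated by the `e_{st}` (the two coincide). -/
def Fideal : Submodule (In K 1) (In K 1) :=
  Submodule.span (In K 1) {a | ∃ s t : ℕ, a = eEl1 K s t}

/-- The left ideal `F + 𝕀_1 (H − μ)^s`. -/
def MslIdeal (s : ℕ) (mu : K) : Submodule (In K 1) (In K 1) :=
  Fideal K ⊔ Submodule.span (In K 1) {(HEl K 1 0 - algebraMap K (In K 1) mu) ^ s}

/-- The `𝕀_1`-module `M(s,μ) = 𝕀_1/(F + 𝕀_1 (H − μ)^s)`. -/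
def Msl (s : ℕ) (mu : K) := (In K 1) ⧸ MslIdeal K s mu

instance (s : ℕ) (mu : K) : AddCommGroup (Msl K s mu) :=
  inferInstanceAs (AddCommGroup ((In K 1) ⧸ MslIdeal K s mu))
instance (s : ℕ) (mu : K) : Module (In K 1) (Msl K s mu) :=
  inferInstanceAs (Module (In K 1) ((In K 1) ⧸ MslIdeal K s mu))
instance (s : ℕ) (mu : K) : Module K (Msl K s mu) :=
  inferInstanceAs (Module K ((In K 1) ⧸ MslIdeal K s mu))
instance (s : ℕ) (mu : K) : IsScalarTower K (In K 1) (Msl K s mu) :=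
  inferInstanceAs (IsScalarTower K (In K 1) ((In K 1) ⧸ MslIdeal K s mu))

-- two-sided ideals of I_n
/-- The element `e_{st}(i) ∈ 𝕀_n` built from the `i`-th tensor factor. -/
def eElN (i : Fin n) (s t : ℕ) : In K n :=
  intEl K n i ^ s * dEl K n i ^ t - intEl K n i ^ (s + 1) * dEl K n i ^ (t + 1)

/-- The height one prime `𝔭_i`, the two-sided ideal of `𝕀_n` generated by `F(i)`. -/
def pIdeal (i : Fin n) : TwoSidedIdeal (In K n) :=
  TwoSidedIdeal.span {a | ∃ s t : ℕ, a = eElN K n i s t}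

/-- `𝔞_n(I) = Σ_{i ∈ I} 𝔭_i`. -/
def aIdeal (I : Set (Fin n)) : TwoSidedIdeal (In K n) := ⨆ i ∈ I, pIdeal K n i


-- bundled modules
universe u

/-- A bundled `𝕀_n`-module (with compatible `K`-structure). -/
structure ModN (K : Type u) [Field K] [CharZero K] (n : ℕ) : Type (u + 1) where
  carrier : Type u
  [instAdd : AddCommGroup carrier]
  [instK : Module K carrier]
  [instIn : Module (In K n) carrier]
  [instTower : IsScalarTower K (In K n) carrier]

attribute [instance] ModN.instAdd ModN.instK ModN.instIn ModN.instTower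

/-- The endomorphism of `M_1 ⊗ ⋯ ⊗ M_n` acting by `a ∈ 𝕀_1` on the `i`-th factor. -/
def tprodMap (Mi : Fin n → ModN K 1) (i : Fin n) (a : In K 1) :
    (⨂[K] j, (Mi j).carrier) →ₗ[K] ⨂[K] j, (Mi j).carrier :=
  PiTensorProduct.map (Function.update
    (fun j => (LinearMap.id : (Mi j).carrier →ₗ[K] (Mi j).carrier)) i
    (DistribMulAction.toLinearMap K ((Mi i).carrier) a))

/-- The `𝕀_n`-module `M` "is" the tensor product `M_1 ⊗ ⋯ ⊗ M_n` of the `𝕀_1`-modules `M_i`: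
there is a `K`-linear isomorphism under which the generators `x_i, ∂_i, ∫_i` of `𝕀_n` act on
the `i`-th tensor factor via the corresponding generators of `𝕀_1`. -/
def RealizesTensor (Mi : Fin n → ModN K 1) (M : Type*) [AddCommGroup M] [Module K M]
    [Module (In K n) M] [IsScalarTower K (In K n) M] : Prop :=
  ∃ φ : M ≃ₗ[K] ⨂[K] j, (Mi j).carrier,
    ∀ (i : Fin n) (m : M),
      φ (xEl K n i • m) = tprodMap K n Mi i (xEl K 1 0) (φ m) ∧
      φ (dEl K n i • m) = tprodMap K n Mi i (dEl K 1 0) (φ m) ∧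
      φ (intEl K n i • m) = tprodMap K n Mi i (intEl K 1 0) (φ m)

/-- `M` is (isomorphic to) the simple weight module `M(𝒟_Ω)` attached to the orbit of `λ`
and the subset `𝒟 ⊆ 𝔻_Ω`: the tensor product of copies of `K[x]` (for `i ∈ 𝒟`) and of
`M(1, λ_i)` (for `i ∉ 𝒟`). -/
def RealizesMD (lam : Fin n → K) (D : Set (Fin n)) (M : Type*) [AddCommGroup M] [Module K M]
    [Module (In K n) M] [IsScalarTower K (In K n) M] : Prop :=
  ∃ Mi : Fin n → ModN K 1,
    (∀ i, i ∈ D → Nonempty ((Mi i).carrier ≃ₗ[In K 1] P K 1)) ∧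
    (∀ i, i ∉ D → Nonempty ((Mi i).carrier ≃ₗ[In K 1] Msl K 1 (lam i))) ∧
    RealizesTensor K n Mi M

/-- `M` is (isomorphic to) the module `P_{n-1} ⊗ M(s, λ)` (with the copy of `M(s,λ)` placed
in position `j`). -/
def RealizesPMs (lam : Fin n → K) (j : Fin n) (s : ℕ) (M : Type*) [AddCommGroup M] [Module K M]
    [Module (In K n) M] [IsScalarTower K (In K n) M] : Prop :=
  ∃ Mi : Fin n → ModN K 1,
    (∀ i, i ≠ j → Nonempty ((Mi i).carrier ≃ₗ[In K 1] P K 1)) ∧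
    Nonempty ((Mi j).carrier ≃ₗ[In K 1] Msl K s (lam j)) ∧
    RealizesTensor K n Mi M

/-- Membership in the category `GW(𝕀_n, 𝒟_Ω)`: generalized weight modules with support in the
orbit of `λ` all of whose simple subquotients are isomorphic to `M(𝒟_Ω)`. -/
def InGWD (lam : Fin n → K) (D : Set (Fin n)) (M : Type*) [AddCommGroup M] [Module K M]
    [Module (In K n) M] [IsScalarTower K (In K n) M] : Prop :=
  IsGenWeightModule K n M ∧ supp K n M ⊆ orbitOf K n lam ∧
  ∀ (p q : Submodule (In K n) M), p ≤ q →
    IsSimpleModule (In K n) (q ⧸ Submodule.comap q.subtype p) →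
    RealizesMD K n lam D (q ⧸ Submodule.comap q.subtype p)

/-- The support `S(𝒟_Ω) = ℕ_+^{𝒟_Ω} × ∏_{i ∉ 𝒟_Ω} (λ_i + ℤ)` of the module `M(𝒟_Ω)`. -/
def SuppMD (lam : Fin n → K) (D : Set (Fin n)) : Set (Fin n → K) :=
  {mu | (∀ i ∈ D, ∃ m : ℕ, 0 < m ∧ mu i = (m : K)) ∧
        (∀ i ∉ D, ∃ z : ℤ, mu i = lam i + (z : K))}

/-- `M` is an absolutely prime `𝕀_n`-module: its annihilator is a prime ideal and every
nonzero subfactor of `M` has the same annihilator. -/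
def IsAbsolutelyPrime (M : Type*) [AddCommGroup M] [Module K M]
    [Module (In K n) M] [IsScalarTower K (In K n) M] : Prop :=
  IsPrimeSet K n (annSet K n M) ∧
  ∀ (p q : Submodule (In K n) M), p ≤ q →
    Nontrivial (q ⧸ Submodule.comap q.subtype p) →
    annSet K n (q ⧸ Submodule.comap q.subtype p) = annSet K n M


-- the commutative subalgebra D_n = K[H_1, …, H_n]
lemma xEl_smul (i : Fin n) (p : P K n) : xEl K n i • p = MvPolynomial.X i * p := rfl

lemma dEl_smul (i : Fin n) (p : P K n) : dEl K n i • p = MvPolynomial.pderiv i p := rfl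

lemma hEl_monomial (i : Fin n) (α : Fin n →₀ ℕ) (c : K) :
    HEl K n i • (MvPolynomial.monomial α c : P K n)
      = (((α i : ℕ) : K) + 1) • MvPolynomial.monomial α c := by
  have hx : xEl K n i • (MvPolynomial.monomial α c : P K n)
      = MvPolynomial.monomial (α + Finsupp.single i 1) c := by
    rw [xEl_smul, MvPolynomial.X, MvPolynomial.monomial_mul, one_mul, add_comm]
  rw [HEl, mul_smul, hx, dEl_smul, MvPolynomial.pderiv_monomial,
    add_tsub_cancel_right, MvPolynomial.smul_monomial, Finsupp.add_apply,
    Finsupp.single_eq_same, smul_eq_mul]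
  congr 1
  push_cast
  ring

private lemma In_ext {a b : In K n} (h : ∀ p : P K n, a • p = b • p) : a = b := by
  have : (show InSub K n from a) = (show InSub K n from b) :=
    Subtype.ext (LinearMap.ext fun p => h p)
  exact this

lemma hEl_comm (i j : Fin n) : HEl K n i * HEl K n j = HEl K n j * HEl K n i := by
  apply In_ext
  intro p
  induction p using MvPolynomial.induction_on' with
  | monomial α c =>
      have key : ∀ a b : Fin n, (HEl K n a * HEl K n b) • (MvPolynomial.monomial α c : P K n)
          = ((((α b : ℕ) : K) + 1) * (((α a : ℕ) : K) + 1)) • MvPolynomial.monomial α c := by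
        intro a b
        rw [mul_smul, hEl_monomial, ← smul_comm, hEl_monomial, smul_smul]
      rw [key, key, mul_comm]
  | add p q hp hq =>
      rw [smul_add, smul_add, hp, hq]

/-- `D_n = K[H_1, …, H_n]` as a subalgebra of `𝕀_n`. -/
def DnSub : Subalgebra K (In K n) := Algebra.adjoin K (Set.range (HEl K n))

/-- The commutative algebra `D_n` (as a type). -/
def Dn : Type _ := DnSub K n

instance : CommRing (Dn K n) :=
  Algebra.adjoinCommRingOfComm K (by rintro a ⟨i, rfl⟩ b ⟨j, rfl⟩; exact hEl_comm K n i j)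

instance : Algebra K (Dn K n) := inferInstanceAs (Algebra K (DnSub K n))

/-- The inclusion `D_n → 𝕀_n`. -/
def dnVal : Dn K n →+* In K n := ((DnSub K n).val : DnSub K n →ₐ[K] In K n).toRingHom

/-- `H_i` as an element of `D_n`. -/
def HElD (i : Fin n) : Dn K n :=
  show DnSub K n from ⟨HEl K n i, Algebra.subset_adjoin ⟨i, rfl⟩⟩

lemma dn_comm (d : Dn K n) (i : Fin n) :
    dnVal K n d * HEl K n i = HEl K n i * dnVal K n d := by
  have h1 : DnSub K n ≤ Subalgebra.centralizer K (Set.range (HEl K n)) := by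
    apply Algebra.adjoin_le
    rintro x ⟨j, rfl⟩
    rw [SetLike.mem_coe, Subalgebra.mem_centralizer_iff]
    rintro g ⟨i', rfl⟩
    exact hEl_comm K n i' j
  have h2 := (Subalgebra.mem_centralizer_iff K).mp
    (h1 (show DnSub K n from d).2) (HEl K n i) ⟨i, rfl⟩
  exact h2.symm


section DnModules

variable (M : Type*) [AddCommGroup M] [Module K M] [Module (In K n) M]
  [IsScalarTower K (In K n) M]

lemma genWS_stable (lam : Fin n → K) {m : M} (hm : m ∈ genWeightSpace K n M lam)
    (d : Dn K n) : dnVal K n d • m ∈ genWeightSpace K n M lam := by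
  obtain ⟨N, hN⟩ := hm
  refine ⟨N, fun i => ?_⟩
  have hc : Commute (dnVal K n d) ((HEl K n i - algebraMap K (In K n) (lam i)) ^ N) := by
    apply Commute.pow_right
    exact Commute.sub_right (dn_comm K n d i) ((Algebra.commutes (lam i) (dnVal K n d)).symm)
  rw [← mul_smul, ← hc.eq, mul_smul, hN i, smul_zero]

instance genWS_smul (lam : Fin n → K) : SMul (Dn K n) (genWeightSpace K n M lam) :=
  ⟨fun d w => ⟨dnVal K n d • (w : M), genWS_stable K n M lam w.2 d⟩⟩

instance genWS_module (lam : Fin n → K) : Module (Dn K n) (genWeightSpace K n M lam) :=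
  Module.ofMinimalAxioms
    (fun d x y => Subtype.ext (smul_add (dnVal K n d) (x : M) (y : M)))
    (fun d d' x => Subtype.ext (show dnVal K n (d + d') • (x : M)
      = dnVal K n d • (x : M) + dnVal K n d' • (x : M) by rw [map_add, add_smul]))
    (fun d d' x => Subtype.ext (show dnVal K n (d * d') • (x : M)
      = dnVal K n d • (dnVal K n d' • (x : M)) by rw [map_mul, mul_smul]))
    (fun x => Subtype.ext (show dnVal K n 1 • (x : M) = (x : M) by rw [map_one, one_smul]))

instance genWS_tower (lam : Fin n → K) :
    IsScalarTower K (Dn K n) (genWeightSpace K n M lam) :=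
  ⟨fun c d w => Subtype.ext (show dnVal K n (c • d) • (w : M) = c • (dnVal K n d • (w : M)) by
    rw [show dnVal K n (c • d) = c • dnVal K n d from map_smul (DnSub K n).val c d, smul_assoc])⟩

end DnModules

/-- The maximal ideal `𝔪_λ = (H_1 − λ_1, …, H_n − λ_n)` of `D_n`. -/
def mIdeal (lam : Fin n → K) : Ideal (Dn K n) :=
  Ideal.span {d | ∃ i, d = HElD K n i - algebraMap K (Dn K n) (lam i)}

/-- The category `LF_𝔪(D_n)` of `𝔪_λ`-locally finite `D_n`-modules: every cyclic submodule is
finite dimensional over `K` and annihilated by a power of `𝔪_λ`. -/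
def IsLF (lam : Fin n → K) (N : Type*) [AddCommGroup N] [Module K N] [Module (Dn K n) N]
    [IsScalarTower K (Dn K n) N] : Prop :=
  ∀ x : N, FiniteDimensional K ((Submodule.span (Dn K n) {x}).restrictScalars K) ∧
    ∃ s : ℕ, ∀ i, ((HElD K n i - algebraMap K (Dn K n) (lam i)) ^ s) • x = 0

-- the algebra B_n = 𝕀_n/𝔞_n
/-- The maximal ideal `𝔞_n = 𝔭_1 + ⋯ + 𝔭_n` of `𝕀_n`. -/
def aFull : TwoSidedIdeal (In K n) := aIdeal K n Set.univ

/-- The skew Laurent polynomial algebra `B_n = 𝕀_n/𝔞_n`. -/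
def Bn : Type _ := (aFull K n).ringCon.Quotient

instance : Ring (Bn K n) := inferInstanceAs (Ring (aFull K n).ringCon.Quotient)

/-- The quotient map `𝕀_n → B_n`. -/
def toBn : In K n →+* Bn K n := RingCon.mk' _

lemma toBn_surjective : Function.Surjective (toBn K n) :=
  Quotient.mk''_surjective

/-- The composite `D_n → 𝕀_n → B_n`. -/
def bnD : Dn K n →+* Bn K n := (toBn K n).comp (dnVal K n)

/-- `B_n` as a right `D_n`-module (written as a left module structure, `d • b = b ⬝ d`). -/
instance : SMul (Dn K n) (Bn K n) := ⟨fun d b => b * bnD K n d⟩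

instance : Module (Dn K n) (Bn K n) :=
  Module.ofMinimalAxioms
    (fun d x y => show (x + y) * bnD K n d = x * bnD K n d + y * bnD K n d from add_mul _ _ _)
    (fun d d' x => show x * bnD K n (d + d') = x * bnD K n d + x * bnD K n d' by
      rw [map_add, mul_add])
    (fun d d' x => show x * bnD K n (d * d') = (x * bnD K n d') * bnD K n d by
      rw [mul_comm d d', map_mul, ← mul_assoc])
    (fun x => show x * bnD K n 1 = x by rw [map_one, mul_one])

instance : SMulCommClass (Dn K n) (Bn K n) (Bn K n) :=
  ⟨fun d b m => show (b * m) * bnD K n d = b * (m * bnD K n d) from mul_assoc b m (bnD K n d)⟩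

/-- The induced module `B_n ⊗_{D_n} N` of a `D_n`-module `N`. -/
def Ind (N : Type*) [AddCommGroup N] [Module (Dn K n) N] : Type _ :=
  (Bn K n) ⊗[Dn K n] N

section Ind

variable (N : Type*) [AddCommGroup N] [Module (Dn K n) N]

instance : AddCommGroup (Ind K n N) :=
  inferInstanceAs (AddCommGroup ((Bn K n) ⊗[Dn K n] N))

instance indModuleBn : Module (Bn K n) (Ind K n N) :=
  inferInstanceAs (Module (Bn K n) ((Bn K n) ⊗[Dn K n] N))

instance indModuleDn : Module (Dn K n) (Ind K n N) :=
  inferInstanceAs (Module (Dn K n) ((Bn K n) ⊗[Dn K n] N))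

instance indModuleIn : Module (In K n) (Ind K n N) := Module.compHom _ (toBn K n)

instance indModuleK : Module K (Ind K n N) := Module.compHom _ (algebraMap K (Dn K n))

lemma bn_algebraMap_comm (c : K) (u : Bn K n) :
    toBn K n (algebraMap K (In K n) c) * u = u * toBn K n (algebraMap K (In K n) c) := by
  obtain ⟨r, rfl⟩ := toBn_surjective K n u
  rw [← map_mul, ← map_mul, Algebra.commutes]

lemma dnVal_algebraMap (c : K) :
    dnVal K n (algebraMap K (Dn K n) c) = algebraMap K (In K n) c :=
  AlgHom.commutes (DnSub K n).val c

lemma ind_key (c : K) (w : (Bn K n) ⊗[Dn K n] N) :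
    (toBn K n (algebraMap K (In K n) c)) • w = (algebraMap K (Dn K n) c) • w := by
  induction w using TensorProduct.induction_on with
  | zero => rw [smul_zero, smul_zero]
  | tmul b x =>
      rw [TensorProduct.smul_tmul', TensorProduct.smul_tmul']
      congr 1
      show toBn K n (algebraMap K (In K n) c) * b = b * bnD K n (algebraMap K (Dn K n) c)
      have h1 : bnD K n (algebraMap K (Dn K n) c) = toBn K n (algebraMap K (In K n) c) := by
        show toBn K n (dnVal K n (algebraMap K (Dn K n) c)) = _
        rw [dnVal_algebraMap]
      rw [h1, bn_algebraMap_comm]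
  | add x y hx hy => rw [smul_add, smul_add, hx, hy]

instance indTower : IsScalarTower K (In K n) (Ind K n N) := by
  constructor
  intro c a v
  show toBn K n (c • a) • v = algebraMap K (Dn K n) c • ((toBn K n a : Bn K n) • v)
  rw [Algebra.smul_def, map_mul, mul_smul]
  exact ind_key K n N c _

end Ind


section BnQuot

variable (J : Submodule (Bn K n) (Bn K n))

instance : Module (In K n) (Bn K n ⧸ J) := Module.compHom _ (toBn K n)

instance : Module K (Bn K n ⧸ J) :=
  Module.compHom _ ((toBn K n).comp (algebraMap K (In K n)))

instance : IsScalarTower K (In K n) (Bn K n ⧸ J) := by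
  constructor
  intro c a v
  show toBn K n (c • a) • v = (toBn K n (algebraMap K (In K n) c)) • (toBn K n a • v)
  rw [Algebra.smul_def, map_mul, mul_smul]

end BnQuot

/-- The `𝕀_n`-module `M` "is" the tensor product `A ⊗ B` of an `𝕀_m`-module `A` and an
`𝕀_{n-m}`-module `B`: there is a `K`-linear isomorphism under which the generators of `𝕀_n`
with index `< m` act on the first factor (via the corresponding generators of `𝕀_m`) and the
remaining generators act on the second factor (via the generators of `𝕀_{n-m}`). -/
def RealizesSplit (m : ℕ) (A : Type*) [AddCommGroup A] [Module K A] [Module (In K m) A]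
    [IsScalarTower K (In K m) A]
    (B : Type*) [AddCommGroup B] [Module K B] [Module (In K (n - m)) B]
    [IsScalarTower K (In K (n - m)) B]
    (M : Type*) [AddCommGroup M] [Module K M] [Module (In K n) M]
    [IsScalarTower K (In K n) M] : Prop :=
  ∃ φ : M ≃ₗ[K] A ⊗[K] B,
    (∀ (i : Fin n) (hi : (i : ℕ) < m) (v : M),
      φ (xEl K n i • v) = LinearMap.rTensor B
        (DistribMulAction.toLinearMap K A (xEl K m ⟨i, hi⟩)) (φ v) ∧
      φ (dEl K n i • v) = LinearMap.rTensor B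
        (DistribMulAction.toLinearMap K A (dEl K m ⟨i, hi⟩)) (φ v) ∧
      φ (intEl K n i • v) = LinearMap.rTensor B
        (DistribMulAction.toLinearMap K A (intEl K m ⟨i, hi⟩)) (φ v)) ∧
    (∀ (i : Fin n) (hi : m ≤ (i : ℕ)) (v : M),
      φ (xEl K n i • v) = LinearMap.lTensor A
        (DistribMulAction.toLinearMap K B (xEl K (n - m) ⟨(i : ℕ) - m, by omega⟩)) (φ v) ∧
      φ (dEl K n i • v) = LinearMap.lTensor A
        (DistribMulAction.toLinearMap K B (dEl K (n - m) ⟨(i : ℕ) - m, by omega⟩)) (φ v) ∧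
      φ (intEl K n i • v) = LinearMap.lTensor A
        (DistribMulAction.toLinearMap K B (intEl K (n - m) ⟨(i : ℕ) - m, by omega⟩)) (φ v))

end


/-! ### Helper lemmas -/

section Aux

variable (K : Type*) [Field K] [CharZero K] (n : ℕ)

lemma intEl_mon (i : Fin n) (α : Fin n →₀ ℕ) (c : K) :
    intEl K n i • (MvPolynomial.monomial α c : P K n)
      = MvPolynomial.monomial (α + Finsupp.single i 1) ((((α i : ℕ) : K) + 1)⁻¹ * c) := by
  have h1 : (MvPolynomial.monomial α c : P K n)
      = c • (MvPolynomial.basisMonomials (Fin n) K) α := by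
    rw [MvPolynomial.coe_basisMonomials, MvPolynomial.smul_monomial, smul_eq_mul, mul_one]
  have h2 : intEl K n i • (MvPolynomial.monomial α c : P K n)
      = intOp K n i (MvPolynomial.monomial α c) := rfl
  rw [h2, h1, map_smul, intOp, Module.Basis.constr_basis, MvPolynomial.smul_monomial,
    MvPolynomial.smul_monomial]
  simp [mul_comm]

lemma dEl_mon (i : Fin n) (α : Fin n →₀ ℕ) (c : K) :
    dEl K n i • (MvPolynomial.monomial α c : P K n)
      = MvPolynomial.monomial (α - Finsupp.single i 1) (c * ((α i : ℕ) : K)) := by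
  rw [dEl_smul, MvPolynomial.pderiv_monomial]

lemma HEl_mon (i : Fin n) (α : Fin n →₀ ℕ) (c : K) :
    HEl K n i • (MvPolynomial.monomial α c : P K n)
      = MvPolynomial.monomial α ((((α i : ℕ) : K) + 1) * c) := by
  rw [hEl_monomial, MvPolynomial.smul_monomial, smul_eq_mul]

lemma xEl_mon (i : Fin n) (α : Fin n →₀ ℕ) (c : K) :
    xEl K n i • (MvPolynomial.monomial α c : P K n)
      = MvPolynomial.monomial (α + Finsupp.single i 1) c := by
  rw [xEl_smul, MvPolynomial.X, MvPolynomial.monomial_mul, one_mul, add_comm]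

lemma In_ext_mon {a b : In K n}
    (h : ∀ (α : Fin n →₀ ℕ) (c : K), a • (MvPolynomial.monomial α c : P K n)
      = b • (MvPolynomial.monomial α c : P K n)) : a = b := by
  apply In_ext
  intro p
  induction p using MvPolynomial.induction_on' with
  | monomial α c => exact h α c
  | add p q hp hq => rw [smul_add, smul_add, hp, hq]

lemma d_int (i : Fin n) : dEl K n i * intEl K n i = 1 := by
  apply In_ext_mon
  intro α c
  have h : (((α i : ℕ) : K) + 1) ≠ 0 := Nat.cast_add_one_ne_zero _
  rw [mul_smul, intEl_mon, dEl_mon, one_smul, add_tsub_cancel_right]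
  congr 1
  simp
  field_simp

lemma x_eq (i : Fin n) : xEl K n i = intEl K n i * HEl K n i := by
  apply In_ext_mon
  intro α c
  have h : (((α i : ℕ) : K) + 1) ≠ 0 := Nat.cast_add_one_ne_zero _
  rw [mul_smul, HEl_mon, intEl_mon, xEl_mon]
  congr 1
  field_simp

lemma dd_comm (i j : Fin n) : Commute (dEl K n i) (dEl K n j) := by
  apply In_ext_mon
  intro α c
  rw [mul_smul, mul_smul, dEl_mon, dEl_mon, dEl_mon, dEl_mon]
  rcases eq_or_ne i j with rfl | hij
  · rfl
  · rw [tsub_right_comm]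
    congr 1
    simp [hij, hij.symm, Finsupp.single_apply]
    ring

lemma ii_comm (i j : Fin n) : Commute (intEl K n i) (intEl K n j) := by
  apply In_ext_mon
  intro α c
  rw [mul_smul, mul_smul, intEl_mon, intEl_mon, intEl_mon, intEl_mon]
  rcases eq_or_ne i j with rfl | hij
  · rfl
  · rw [add_right_comm]
    congr 1
    simp [hij, hij.symm, Finsupp.single_apply]
    ring

lemma di_comm {i j : Fin n} (hij : i ≠ j) : Commute (dEl K n i) (intEl K n j) := by
  apply In_ext_mon
  intro α c
  rw [mul_smul, mul_smul, intEl_mon, dEl_mon, dEl_mon, intEl_mon]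
  have h : α + Finsupp.single j 1 - Finsupp.single i 1
      = α - Finsupp.single i 1 + Finsupp.single j 1 := by
    ext k
    simp only [Finsupp.tsub_apply, Finsupp.add_apply, Finsupp.single_apply]
    rcases eq_or_ne i k with rfl | hik
    · simp [hij.symm]
    · simp [hik]
  rw [h]
  congr 1
  simp [hij, hij.symm, Finsupp.single_apply]
  ring

lemma H_int_ne {i j : Fin n} (hij : i ≠ j) : Commute (HEl K n i) (intEl K n j) := by
  apply In_ext_mon
  intro α c
  rw [mul_smul, mul_smul, intEl_mon, HEl_mon, HEl_mon, intEl_mon]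
  congr 1
  simp [hij, hij.symm, Finsupp.single_apply]
  ring

lemma H_d_ne {i j : Fin n} (hij : i ≠ j) : Commute (HEl K n i) (dEl K n j) := by
  apply In_ext_mon
  intro α c
  rw [mul_smul, mul_smul, dEl_mon, HEl_mon, HEl_mon, dEl_mon]
  congr 1
  simp [hij, hij.symm, Finsupp.single_apply]
  ring

lemma H_int (i : Fin n) : HEl K n i * intEl K n i = intEl K n i * (HEl K n i + 1) := by
  apply In_ext_mon
  intro α c
  rw [mul_smul, mul_smul, add_smul, one_smul, smul_add, intEl_mon, HEl_mon, HEl_mon, intEl_mon,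
    ← map_add]
  congr 1
  simp
  ring

lemma H_d (i : Fin n) : HEl K n i * dEl K n i = dEl K n i * (HEl K n i - 1) := by
  apply In_ext_mon
  intro α c
  rw [mul_smul, mul_smul, sub_smul, one_smul, smul_sub, dEl_mon, HEl_mon, HEl_mon, dEl_mon,
    ← map_sub]
  congr 1
  rcases Nat.eq_zero_or_pos (α i) with h | h
  · simp [h]
  · simp [Nat.cast_sub (Nat.succ_le_of_lt h)]
    ring

lemma e_H (i : Fin n) : (1 - intEl K n i * dEl K n i) * HEl K n i
    = 1 - intEl K n i * dEl K n i := by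
  apply In_ext_mon
  intro α c
  rw [mul_smul, sub_smul, sub_smul, one_smul, one_smul, mul_smul, mul_smul, HEl_mon, dEl_mon,
    dEl_mon, intEl_mon, intEl_mon]
  rcases Nat.eq_zero_or_pos (α i) with h | h
  · simp [h]
  · have h1 : α - Finsupp.single i 1 + Finsupp.single i 1 = α := by
      apply tsub_add_cancel_of_le
      rw [Finsupp.single_le_iff]; exact h
    have h2 : ((α i : ℕ) : K) ≠ 0 := Nat.cast_ne_zero.2 h.ne'
    rw [h1, ← map_sub, ← map_sub]
    congr 1
    simp [Nat.cast_sub (Nat.succ_le_of_lt h)]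
    field_simp
    ring

lemma In_induction {p : In K n → Prop} (halg : ∀ c : K, p (algebraMap K (In K n) c))
    (hd : ∀ i, p (dEl K n i)) (hi : ∀ i, p (intEl K n i)) (hx : ∀ i, p (xEl K n i))
    (hadd : ∀ a b, p a → p b → p (a + b)) (hmul : ∀ a b, p a → p b → p (a * b)) (a : In K n) :
    p a := by
  obtain ⟨a, ha⟩ := a
  induction ha using Algebra.adjoin_induction with
  | mem x hx' =>
    rcases hx' with (⟨i, rfl⟩ | ⟨i, rfl⟩) | ⟨i, rfl⟩
    · exact hx i
    · exact hd i
    · exact hi i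
  | algebraMap r => exact halg r
  | add x y hx hy h1 h2 => exact hadd _ _ h1 h2
  | mul x y hx hy h1 h2 => exact hmul _ _ h1 h2

/-! #### The elements `t_z` -/

/-- `∫^k` or `∂^{-k}`. -/
noncomputable def uEl (i : Fin n) (k : ℤ) : In K n := intEl K n i ^ k.toNat * dEl K n i ^ (-k).toNat

/-- the idempotents `∫^m ∂^m`. -/
noncomputable def pEl (i : Fin n) (m : ℕ) : In K n := intEl K n i ^ m * dEl K n i ^ m

lemma dpow_ipow (i : Fin n) (m : ℕ) : dEl K n i ^ m * intEl K n i ^ m = 1 := by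
  induction m with
  | zero => simp
  | succ m ih =>
    rw [pow_succ (dEl K n i), pow_succ' (intEl K n i), mul_assoc, ← mul_assoc (dEl K n i),
      d_int, one_mul, ih]

lemma d_u (i : Fin n) (k : ℤ) : dEl K n i * uEl K n i k = uEl K n i (k - 1) := by
  unfold uEl
  rcases le_or_gt k 0 with h | h
  · obtain ⟨m, rfl⟩ := Int.exists_eq_neg_ofNat h
    have h1 : (-(m : ℤ) - 1).toNat = 0 := by omega
    have h2 : (-(-(m : ℤ) - 1)).toNat = m + 1 := by omega
    have h3 : (-(m : ℤ)).toNat = 0 := by omega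
    have h4 : (-(-(m : ℤ))).toNat = m := by omega
    rw [h1, h2, h3, h4, pow_zero, one_mul, one_mul, pow_succ']
  · obtain ⟨m, rfl⟩ : ∃ m : ℕ, k = m + 1 := ⟨(k - 1).toNat, by omega⟩
    have h1 : ((m : ℤ) + 1).toNat = m + 1 := by omega
    have h2 : (-((m : ℤ) + 1)).toNat = 0 := by omega
    have h3 : ((m : ℤ) + 1 - 1).toNat = m := by omega
    have h4 : (-((m : ℤ) + 1 - 1)).toNat = 0 := by omega
    rw [h1, h2, h3, h4, pow_zero, mul_one, mul_one, pow_succ', ← mul_assoc, d_int, one_mul]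

lemma i_u (i : Fin n) (k : ℤ) :
    intEl K n i * uEl K n i k = uEl K n i (k + 1) * pEl K n i (-k).toNat := by
  unfold uEl pEl
  rcases le_or_gt 0 k with h | h
  · have h1 : (k + 1).toNat = k.toNat + 1 := by omega
    have h2 : (-k).toNat = 0 := by omega
    have h3 : (-(k + 1)).toNat = 0 := by omega
    rw [h1, h2, h3]
    simp [pow_succ']
  · obtain ⟨m, rfl⟩ : ∃ m : ℕ, k = -((m : ℤ) + 1) := ⟨(-k - 1).toNat, by omega⟩
    have h1 : (-((m : ℤ) + 1)).toNat = 0 := by omega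
    have h2 : (-(-((m : ℤ) + 1))).toNat = m + 1 := by omega
    have h3 : (-((m : ℤ) + 1) + 1).toNat = 0 := by omega
    have h4 : (-(-((m : ℤ) + 1) + 1)).toNat = m := by omega
    rw [h1, h2, h3, h4, pow_zero, one_mul, one_mul, pow_succ (intEl K n i), ← mul_assoc,
      ← mul_assoc, dpow_ipow, one_mul]

lemma H_ipow (i : Fin n) (m : ℕ) :
    HEl K n i * intEl K n i ^ m = intEl K n i ^ m * (HEl K n i + (m : In K n)) := by
  induction m with
  | zero => simp
  | succ m ih =>
    rw [pow_succ, ← mul_assoc, ih, mul_assoc, mul_assoc, add_mul, H_int, Nat.cast_comm, ← mul_add]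
    push_cast
    rw [add_assoc, add_comm 1 (m : In K n)]

lemma H_dpow (i : Fin n) (m : ℕ) :
    HEl K n i * dEl K n i ^ m = dEl K n i ^ m * (HEl K n i - (m : In K n)) := by
  induction m with
  | zero => simp
  | succ m ih =>
    rw [pow_succ, ← mul_assoc, ih, mul_assoc, mul_assoc, sub_mul, H_d, Nat.cast_comm, ← mul_sub]
    push_cast
    rw [sub_sub, add_comm 1 (m : In K n)]

lemma H_p (i j : Fin n) (m : ℕ) : Commute (HEl K n i) (pEl K n j m) := by
  unfold pEl
  rcases eq_or_ne i j with rfl | hij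
  · rw [Commute, SemiconjBy, ← mul_assoc, H_ipow, mul_assoc, add_mul, H_dpow, Nat.cast_comm,
      ← mul_add, sub_add_cancel, mul_assoc]
  · exact ((H_int_ne K n hij).pow_right m).mul_right ((H_d_ne K n hij).pow_right m)

lemma H_u (i : Fin n) (k : ℤ) :
    HEl K n i * uEl K n i k = uEl K n i k * (HEl K n i + (k : In K n)) := by
  unfold uEl
  rcases le_or_gt 0 k with h | h
  · obtain ⟨m, rfl⟩ := Int.eq_ofNat_of_zero_le h
    simp [H_ipow]
  · obtain ⟨m, rfl⟩ := Int.exists_eq_neg_ofNat h.le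
    simp [H_dpow, sub_eq_add_neg]

lemma p_zero (i : Fin n) : pEl K n i 0 = 1 := by simp [pEl]

lemma p_idem (i : Fin n) (m : ℕ) : pEl K n i m * pEl K n i m = pEl K n i m := by
  unfold pEl
  rw [mul_assoc, ← mul_assoc (dEl K n i ^ m), dpow_ipow, one_mul]

lemma p_mul_p (i : Fin n) (m k : ℕ) : pEl K n i m * pEl K n i (m + k) = pEl K n i (m + k) := by
  unfold pEl
  rw [pow_add (intEl K n i), mul_assoc, mul_assoc (intEl K n i ^ m), ← mul_assoc (dEl K n i ^ m),
    dpow_ipow, one_mul]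

lemma p_mul_p' (i : Fin n) (m k : ℕ) : pEl K n i (m + k) * pEl K n i m = pEl K n i (m + k) := by
  unfold pEl
  rw [add_comm m k, pow_add (dEl K n i), mul_assoc, mul_assoc (dEl K n i ^ k),
    ← mul_assoc (dEl K n i ^ m), dpow_ipow, one_mul]

/-- two elements supported at different coordinates commute. -/
lemma u_comm_d {i j : Fin n} (hij : i ≠ j) (k : ℤ) : Commute (dEl K n i) (uEl K n j k) :=
  ((di_comm K n hij).pow_right _).mul_right ((dd_comm K n i j).pow_right _)

lemma u_comm_i {i j : Fin n} (hij : i ≠ j) (k : ℤ) : Commute (intEl K n i) (uEl K n j k) :=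
  ((ii_comm K n i j).pow_right _).mul_right ((di_comm K n hij.symm).symm.pow_right _)

lemma u_comm_H {i j : Fin n} (hij : i ≠ j) (k : ℤ) : Commute (HEl K n i) (uEl K n j k) :=
  ((H_int_ne K n hij).pow_right _).mul_right ((H_d_ne K n hij).pow_right _)

lemma u_comm_u {i j : Fin n} (hij : i ≠ j) (k l : ℤ) : Commute (uEl K n i k) (uEl K n j l) :=
  ((u_comm_i K n hij l).pow_left _).mul_left ((u_comm_d K n hij l).pow_left _)

lemma p_comm_p (i j : Fin n) (m k : ℕ) : Commute (pEl K n i m) (pEl K n j k) := by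
  rcases eq_or_ne i j with rfl | hij
  · rcases le_total m k with h | h
    · obtain ⟨l, rfl⟩ := Nat.exists_eq_add_of_le h
      rw [Commute, SemiconjBy, p_mul_p, p_mul_p']
    · obtain ⟨l, rfl⟩ := Nat.exists_eq_add_of_le h
      rw [Commute, SemiconjBy, p_mul_p, p_mul_p']
  · have hi : ∀ r : In K n, Commute r (intEl K n j) → Commute r (dEl K n j) →
        Commute r (pEl K n j k) := fun r h1 h2 => (h1.pow_right _).mul_right (h2.pow_right _)
    exact ((hi _ (ii_comm K n i j) (di_comm K n hij.symm).symm).pow_left _).mul_left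
      ((hi _ (di_comm K n hij) (dd_comm K n i j)).pow_left _)

/-- partial products. -/
noncomputable def rEl (s : Finset (Fin n)) (z : Fin n → ℤ) : In K n :=
  s.noncommProd (fun i => uEl K n i (z i)) (fun i _ j _ hij => u_comm_u K n hij (z i) (z j))

lemma r_congr (s : Finset (Fin n)) {z w : Fin n → ℤ} (h : ∀ i ∈ s, z i = w i) :
    rEl K n s z = rEl K n s w :=
  Finset.noncommProd_congr rfl (fun i hi => by rw [h i hi]) _

lemma r_comm {i : Fin n} (z : Fin n → ℤ) (a : In K n)
    (h : ∀ j, i ≠ j → ∀ k, Commute a (uEl K n j k)) :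
    Commute a (rEl K n (Finset.univ.erase i) z) :=
  Finset.noncommProd_commute _ _ _ _ (fun j hj => h j (Finset.ne_of_mem_erase hj).symm _)

/-- `t_z`. -/
noncomputable def tEl (z : Fin n → ℤ) : In K n := rEl K n Finset.univ z

lemma t_eq (z : Fin n → ℤ) (i : Fin n) :
    tEl K n z = uEl K n i (z i) * rEl K n (Finset.univ.erase i) z :=
  (Finset.mul_noncommProd_erase Finset.univ (Finset.mem_univ i)
    (fun i => uEl K n i (z i)) (fun i _ j _ hij => u_comm_u K n hij (z i) (z j)) _).symm

lemma t_zero : tEl K n 0 = 1 := by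
  unfold tEl rEl
  refine (Finset.noncommProd_eq_pow_card _ _ _ 1 ?_).trans (one_pow _)
  intro i _
  simp [uEl]

lemma d_t (i : Fin n) (z : Fin n → ℤ) :
    dEl K n i * tEl K n z = tEl K n (Function.update z i (z i - 1)) := by
  rw [t_eq K n z i, t_eq K n _ i, ← mul_assoc, d_u, Function.update_self]
  congr 1
  apply r_congr
  intro j hj
  rw [Function.update_of_ne (Finset.ne_of_mem_erase hj)]

lemma i_t (i : Fin n) (z : Fin n → ℤ) :
    intEl K n i * tEl K n z
      = tEl K n (Function.update z i (z i + 1)) * pEl K n i (-(z i)).toNat := by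
  rw [t_eq K n z i, t_eq K n _ i, ← mul_assoc, i_u, Function.update_self, mul_assoc, mul_assoc]
  congr 1
  rw [r_congr K n (Finset.univ.erase i) (z := Function.update z i (z i + 1)) (w := z)]
  · apply r_comm
    intro j hij k
    exact ((u_comm_i K n hij k).pow_left _).mul_left ((u_comm_d K n hij k).pow_left _)
  · intro j hj
    rw [Function.update_of_ne (Finset.ne_of_mem_erase hj)]

lemma H_t (i : Fin n) (z : Fin n → ℤ) :
    HEl K n i * tEl K n z = tEl K n z * (HEl K n i + ((z i : ℤ) : In K n)) := by
  rw [t_eq K n z i, ← mul_assoc, H_u, mul_assoc, mul_assoc]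
  congr 1
  apply Commute.add_left
  · exact r_comm K n z _ (fun j hij k => u_comm_H K n hij k)
  · exact Int.cast_commute _ _

end Aux

section Aux2

variable {K : Type*} [Field K] [CharZero K] {n : ℕ}

lemma exists_stable {V : Type*} [AddCommGroup V] [Module K V] {ι : Type*} (s : Finset ι)
    (f : ι → Module.End K V) (hcomm : ∀ i j, Commute (f i) (f j)) (v : V)
    (halg : ∀ i ∈ s, ∃ (N : ℕ) (c : K), ((f i) ^ (N + 1)) v = c • ((f i) ^ N) v) :
    ∃ W : Submodule K V, FiniteDimensional K W ∧ v ∈ W ∧ (∀ i ∈ s, ∀ w ∈ W, f i w ∈ W) ∧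
      (∀ h : Module.End K V, (∀ i, Commute h (f i)) → h v = 0 → ∀ w ∈ W, h w = 0) := by
  classical
  induction s using Finset.induction_on with
  | empty =>
    refine ⟨Submodule.span K {v}, inferInstance, Submodule.mem_span_singleton_self v,
      by simp, ?_⟩
    intro h _ hv w hw
    obtain ⟨c, rfl⟩ := Submodule.mem_span_singleton.1 hw
    rw [map_smul, hv, smul_zero]
  | insert a s ha ih =>
    obtain ⟨W, hfin, hv, hst, hz⟩ := ih (fun i hi => halg i (Finset.mem_insert_of_mem hi))
    obtain ⟨N, c, hN⟩ := halg a (Finset.mem_insert_self a s)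
    have hN' : ∀ w ∈ W, ((f a) ^ (N + 1)) w = c • ((f a) ^ N) w := by
      intro w hw
      have h1 := hz ((f a) ^ (N + 1) - c • (f a) ^ N) ?_ ?_ w hw
      · rw [LinearMap.sub_apply, LinearMap.smul_apply, sub_eq_zero] at h1
        exact h1
      · intro i
        exact ((hcomm a i).pow_left _).sub_left (((hcomm a i).pow_left _).smul_left c)
      · rw [LinearMap.sub_apply, LinearMap.smul_apply, hN, sub_self]
    have hmem : ∀ k ≤ N, ∀ w ∈ W,
        ((f a) ^ k) w ∈ ⨆ k : Fin (N + 1), W.map ((f a) ^ (k : ℕ)) := by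
      intro k hk w hw
      exact Submodule.mem_iSup_of_mem (⟨k, by omega⟩ : Fin (N + 1))
        (Submodule.mem_map_of_mem hw)
    refine ⟨⨆ k : Fin (N + 1), W.map ((f a) ^ (k : ℕ)), inferInstance, ?_, ?_, ?_⟩
    · simpa using hmem 0 (Nat.zero_le _) v hv
    · intro i hi
      have key : (⨆ k : Fin (N + 1), W.map ((f a) ^ (k : ℕ)))
          ≤ (⨆ k : Fin (N + 1), W.map ((f a) ^ (k : ℕ))).comap (f i) := by
        apply iSup_le
        intro k
        rw [Submodule.map_le_iff_le_comap]
        intro w hw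
        rw [Submodule.mem_comap, Submodule.mem_comap]
        rcases Finset.mem_insert.1 hi with rfl | his
        · have h1 : f i (((f i) ^ (k : ℕ)) w) = ((f i) ^ ((k : ℕ) + 1)) w := by
            rw [pow_succ']; rfl
          rw [h1]
          rcases Nat.lt_or_ge (k : ℕ) N with hk | hk
          · exact hmem _ hk w hw
          · have : (k : ℕ) = N := by omega
            rw [this, hN' w hw]
            exact Submodule.smul_mem _ _ (hmem N le_rfl w hw)
        · have h1 : f i (((f a) ^ (k : ℕ)) w) = ((f a) ^ (k : ℕ)) (f i w) :=
            LinearMap.congr_fun ((hcomm i a).pow_right (k : ℕ)).eq w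
          rw [h1]
          exact hmem _ (by omega) _ (hst i his w hw)
      exact fun w hw => key hw
    · intro h hc hv0
      have key : (⨆ k : Fin (N + 1), W.map ((f a) ^ (k : ℕ))) ≤ LinearMap.ker h := by
        apply iSup_le
        intro k
        rw [Submodule.map_le_iff_le_comap]
        intro w hw
        rw [Submodule.mem_comap, LinearMap.mem_ker]
        have h1 : h (((f a) ^ (k : ℕ)) w) = ((f a) ^ (k : ℕ)) (h w) :=
          LinearMap.congr_fun ((hc a).pow_right (k : ℕ)).eq w
        rw [h1, hz h hc hv0 w hw, map_zero]
      exact fun w hw => key hw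

variable {M : Type*} [AddCommGroup M] [Module K M] [Module (In K n) M]
  [IsScalarTower K (In K n) M]

lemma gw_shift {a : In K n} {lam mu : Fin n → K}
    (h : ∀ j, HEl K n j * a = a * (HEl K n j + algebraMap K (In K n) (mu j - lam j)))
    {m : M} (hm : m ∈ genWeightSpace K n M lam) : a • m ∈ genWeightSpace K n M mu := by
  obtain ⟨N, hN⟩ := hm
  refine ⟨N, fun j => ?_⟩
  have h1 : SemiconjBy a (HEl K n j - algebraMap K (In K n) (lam j))
      (HEl K n j - algebraMap K (In K n) (mu j)) := by
    rw [SemiconjBy, sub_mul, h j, Algebra.commutes, ← mul_sub, map_sub]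
    congr 1
    abel
  rw [← mul_smul, ← (h1.pow_right N).eq, mul_smul, hN j, smul_zero]

lemma gw_d (i : Fin n) {mu : Fin n → K} {m : M} (hm : m ∈ genWeightSpace K n M mu) :
    dEl K n i • m ∈ genWeightSpace K n M (Function.update mu i (mu i - 1)) := by
  refine gw_shift (fun j => ?_) hm
  rcases eq_or_ne j i with rfl | hij
  · rw [H_d, Function.update_self]
    simp [sub_eq_add_neg]
  · rw [Function.update_of_ne hij, sub_self, map_zero, add_zero, (H_d_ne K n hij).eq]

lemma gw_i (i : Fin n) {mu : Fin n → K} {m : M} (hm : m ∈ genWeightSpace K n M mu) :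
    intEl K n i • m ∈ genWeightSpace K n M (Function.update mu i (mu i + 1)) := by
  refine gw_shift (fun j => ?_) hm
  rcases eq_or_ne j i with rfl | hij
  · rw [H_int, Function.update_self]
    simp
  · rw [Function.update_of_ne hij, sub_self, map_zero, add_zero, (H_int_ne K n hij).eq]

lemma gw_t (z : Fin n → ℤ) {mu : Fin n → K} {m : M} (hm : m ∈ genWeightSpace K n M mu) :
    tEl K n z • m ∈ genWeightSpace K n M (fun j => mu j + (z j : K)) := by
  refine gw_shift (fun j => ?_) hm
  rw [H_t, add_sub_cancel_left, map_intCast]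

lemma gw_dpow (i : Fin n) (k : ℕ) {mu : Fin n → K} {m : M}
    (hm : m ∈ genWeightSpace K n M mu) :
    dEl K n i ^ k • m ∈ genWeightSpace K n M (Function.update mu i (mu i - k)) := by
  induction k with
  | zero => simpa using hm
  | succ k ih =>
    have := gw_d i ih
    rw [Function.update_self, Function.update_idem, ← mul_smul, ← pow_succ', sub_sub] at this
    simpa using this

lemma int_d_smul (i : Fin n) {mu : Fin n → K} {m : M}
    (hm : m ∈ genWeightSpace K n M mu) (h1 : mu i ≠ 1) :
    intEl K n i • dEl K n i • m = m := by
  obtain ⟨N, hN⟩ := hm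
  have key : ∀ N : ℕ, (1 - intEl K n i * dEl K n i)
      * (HEl K n i - algebraMap K (In K n) (mu i)) ^ N
      = ((1 - mu i) ^ N) • (1 - intEl K n i * dEl K n i) := by
    intro N
    induction N with
    | zero => simp
    | succ N ih =>
      rw [pow_succ, ← mul_assoc, ih, smul_mul_assoc, mul_sub, e_H, ← Algebra.commutes,
        ← Algebra.smul_def, pow_succ, mul_smul, sub_smul (1 : K), one_smul]
  have h2 := congrArg (· • m) (key N)
  simp only [mul_smul, hN i, smul_zero, smul_assoc] at h2
  have h3 := (smul_eq_zero.1 h2.symm).resolve_left (pow_ne_zero _ (sub_ne_zero.2 h1.symm))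
  rw [sub_smul, one_smul, sub_eq_zero, mul_smul] at h3
  exact h3.symm

lemma p_step (i : Fin n) (k : ℕ) {mu : Fin n → K} {m : M}
    (hm : m ∈ genWeightSpace K n M mu) (h1 : mu i - k ≠ 1) :
    pEl K n i (k + 1) • m = pEl K n i k • m := by
  have h2 := int_d_smul i (gw_dpow i k hm) (by rwa [Function.update_self])
  unfold pEl
  rw [pow_succ (intEl K n i), pow_succ' (dEl K n i), mul_smul, mul_smul, mul_smul, h2, mul_smul]

lemma p_stab (mu : Fin n → K) : ∃ k0 : ℕ, ∀ (i : Fin n) (m : M), m ∈ genWeightSpace K n M mu →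
    ∀ k, k0 ≤ k → pEl K n i k • m = pEl K n i k0 • m := by
  have h : ∀ i : Fin n, ∃ k0 : ℕ, ∀ k : ℕ, k0 ≤ k → mu i - k ≠ 1 := by
    intro i
    by_cases h : ∃ k : ℕ, mu i - k = 1
    · obtain ⟨k, hk⟩ := h
      refine ⟨k + 1, fun l hl hl' => ?_⟩
      have : (k : K) = l := by linear_combination hl' - hk
      have := Nat.cast_injective this
      omega
    · exact ⟨0, fun k _ hk => h ⟨k, hk⟩⟩
  choose k0 hk0 using h
  refine ⟨Finset.univ.sup k0, fun i m hm k hk => ?_⟩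
  induction k, hk using Nat.le_induction with
  | base => rfl
  | succ k hk ih =>
    rw [p_step i k hm (hk0 i k ((Finset.le_sup (Finset.mem_univ i)).trans hk)), ih]

lemma exists_V {mu : Fin n → K} {m : M} (hm : m ∈ genWeightSpace K n M mu) :
    ∃ V : Submodule K M, FiniteDimensional K V ∧ m ∈ V ∧ V ≤ genWeightSpace K n M mu ∧
      (∀ i, ∀ v ∈ V, HEl K n i • v ∈ V) ∧ (∀ i k, ∀ v ∈ V, pEl K n i k • v ∈ V) := by
  classical
  obtain ⟨k0, hk0⟩ := p_stab (M := M) mu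
  obtain ⟨N, hN⟩ := id hm
  let g : (Fin n ⊕ (Fin n × ℕ)) → In K n := fun x =>
    Sum.elim (fun i => HEl K n i - algebraMap K (In K n) (mu i)) (fun q => pEl K n q.1 q.2) x
  have hg : ∀ x y, Commute (g x) (g y) := by
    have hc : ∀ (c : K) (r : In K n), Commute (algebraMap K (In K n) c) r :=
      fun c r => Algebra.commutes c r
    rintro (i | ⟨i, k⟩) (j | ⟨j, l⟩)
    · exact ((show Commute _ _ from hEl_comm K n i j).sub_right (hc _ _).symm).sub_left (hc _ _)
    · exact (H_p K n i j l).sub_left (hc _ _)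
    · exact ((H_p K n j i k).sub_left (hc _ _)).symm
    · exact p_comm_p K n i j k l
  let f : (Fin n ⊕ (Fin n × ℕ)) → Module.End K M := fun x => Algebra.lsmul K K M (g x)
  have hfg : ∀ x (w : M), f x w = g x • w := fun x w => rfl
  have hf : ∀ x y, Commute (f x) (f y) := fun x y => (hg x y).map (Algebra.lsmul K K M)
  let s : Finset (Fin n ⊕ (Fin n × ℕ)) :=
    Finset.univ.disjSum (Finset.univ ×ˢ Finset.range (k0 + 1))
  obtain ⟨V, hfin, hmV, hst, hz⟩ := exists_stable s f hf m (by
    rintro (i | ⟨i, k⟩) _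
    · refine ⟨N, 0, ?_⟩
      have h1 : (f (Sum.inl i) ^ (N + 1)) m = (g (Sum.inl i) ^ (N + 1)) • m := by
        simp only [f, ← map_pow]; rfl
      rw [h1, zero_smul, pow_succ', mul_smul]
      have := hN i
      simp only [g, Sum.elim_inl]
      rw [this, smul_zero]
    · refine ⟨1, 1, ?_⟩
      rw [one_smul, pow_one, pow_succ, pow_one]
      change pEl K n i k • pEl K n i k • m = pEl K n i k • m
      rw [← mul_smul, p_idem])
  have hV : V ≤ genWeightSpace K n M mu := by
    intro v hv
    refine ⟨N, fun i => ?_⟩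
    exact hz (Algebra.lsmul K K M (g (Sum.inl i) ^ N))
      (fun x => ((hg _ x).pow_left N).map (Algebra.lsmul K K M)) (hN i) v hv
  refine ⟨V, hfin, hmV, hV, ?_, ?_⟩
  · intro i v hv
    have h1 := hst (Sum.inl i) (by simp [s]) v hv
    rw [hfg] at h1
    simp only [g, Sum.elim_inl, sub_smul, algebraMap_smul] at h1
    have := V.add_mem h1 (V.smul_mem (mu i) hv)
    simpa using this
  · have hsmall : ∀ i k, k ≤ k0 → ∀ v ∈ V, pEl K n i k • v ∈ V := by
      intro i k hk v hv
      exact hst (Sum.inr (i, k)) (by simp [s]; omega) v hv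
    intro i k v hv
    rcases le_total k k0 with h | h
    · exact hsmall i k h v hv
    · rw [hk0 i v (hV hv) k h]
      exact hsmall i k0 le_rfl v hv

lemma iSup_gw (hgw : IsGenWeightModule K n M) :
    (⨆ mu : Fin n → K, genWeightSpace K n M mu) = ⊤ := by
  letI := Classical.decEq (Fin n → K)
  unfold IsGenWeightModule at hgw
  exact hgw.submodule_iSup_eq_top

lemma indep_gw (hgw : IsGenWeightModule K n M) :
    iSupIndep (fun mu : Fin n → K => genWeightSpace K n M mu) := by
  letI := Classical.decEq (Fin n → K)
  unfold IsGenWeightModule at hgw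
  exact hgw.submodule_iSupIndep

lemma gw_le_of_cover (hgw : IsGenWeightModule K n M) {ι : Type*} (U : ι → Submodule K M)
    (w : ι → Fin n → K) (hU : ∀ x, U x ≤ genWeightSpace K n M (w x)) (htop : ⨆ x, U x = ⊤)
    (mu : Fin n → K) : genWeightSpace K n M mu ≤ ⨆ (x) (_ : w x = mu), U x := by
  set A := ⨆ (x) (_ : w x = mu), U x with hA
  set B := ⨆ (x) (_ : w x ≠ mu), U x with hB
  have hAle : A ≤ genWeightSpace K n M mu := by
    refine iSup₂_le ?_
    rintro x rfl
    exact hU x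
  have hBle : B ≤ ⨆ (nu) (_ : nu ≠ mu), genWeightSpace K n M nu := by
    refine iSup₂_le fun x hx => ?_
    exact (hU x).trans (le_iSup₂_of_le (w x) hx le_rfl)
  have hAB : A ⊔ B = ⊤ := by
    rw [eq_top_iff, ← htop]
    refine iSup_le fun x => ?_
    by_cases hx : w x = mu
    · exact le_sup_of_le_left (le_iSup₂_of_le x hx le_rfl)
    · exact le_sup_of_le_right (le_iSup₂_of_le x hx le_rfl)
  have hdis : Disjoint (genWeightSpace K n M mu) B := (indep_gw hgw mu).mono_right hBle
  calc genWeightSpace K n M mu = (A ⊔ B) ⊓ genWeightSpace K n M mu := by rw [hAB, top_inf_eq]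
    _ = A ⊔ B ⊓ genWeightSpace K n M mu := (sup_inf_assoc_of_le B hAle)
    _ ≤ A := by rw [hdis.symm.eq_bot, sup_bot_eq]

/-- a `K`-subspace stable under the generators is an `𝕀_n`-submodule. -/
lemma stable_of_gens (W : Submodule K M) (hd : ∀ i, ∀ w ∈ W, dEl K n i • w ∈ W)
    (hi : ∀ i, ∀ w ∈ W, intEl K n i • w ∈ W) (hH : ∀ i, ∀ w ∈ W, HEl K n i • w ∈ W)
    (a : In K n) : ∀ w ∈ W, a • w ∈ W := by
  induction a using In_induction with
  | halg c => intro w hw; rw [algebraMap_smul]; exact W.smul_mem c hw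
  | hd i => exact hd i
  | hi i => exact hi i
  | hx i => intro w hw; rw [x_eq, mul_smul]; exact hi i _ (hH i w hw)
  | hadd a b ha hb => intro w hw; rw [add_smul]; exact W.add_mem (ha w hw) (hb w hw)
  | hmul a b ha hb => intro w hw; rw [mul_smul]; exact ha _ (hb w hw)

lemma tV_stable {ι : Type*} (V : ι → Submodule K M)
    (hH : ∀ g i, ∀ v ∈ V g, HEl K n i • v ∈ V g)
    (hp : ∀ g i k, ∀ v ∈ V g, pEl K n i k • v ∈ V g) (a : In K n) :
    ∀ w ∈ ⨆ x : ι × (Fin n → ℤ), (V x.1).map (Algebra.lsmul K K M (tEl K n x.2)),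
      a • w ∈ ⨆ x : ι × (Fin n → ℤ), (V x.1).map (Algebra.lsmul K K M (tEl K n x.2)) := by
  set W := ⨆ x : ι × (Fin n → ℤ), (V x.1).map (Algebra.lsmul K K M (tEl K n x.2)) with hW
  have hmem : ∀ g z, ∀ v ∈ V g, tEl K n z • v ∈ W := by
    intro g z v hv
    exact Submodule.mem_iSup_of_mem (g, z) (Submodule.mem_map_of_mem hv)
  have hred : ∀ b : In K n, (∀ g z, ∀ v ∈ V g, b • tEl K n z • v ∈ W) →
      ∀ w ∈ W, b • w ∈ W := by
    intro b hb
    have : W ≤ W.comap (Algebra.lsmul K K M b) := by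
      conv_lhs => rw [hW]
      refine iSup_le fun x => ?_
      rw [Submodule.map_le_iff_le_comap]
      intro v hv
      exact hb x.1 x.2 v hv
    exact fun w hw => this hw
  refine stable_of_gens W (fun i => hred _ ?_) (fun i => hred _ ?_) (fun i => hred _ ?_) a
  · intro g z v hv
    rw [← mul_smul, d_t]
    exact hmem g _ v hv
  · intro g z v hv
    rw [← mul_smul, i_t, mul_smul]
    exact hmem g _ _ (hp g i _ v hv)
  · intro g z v hv
    rw [← mul_smul, H_t, mul_smul, add_smul]
    refine hmem g _ _ ((V g).add_mem (hH g i v hv) ?_)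
    rw [Int.cast_smul_eq_zsmul]
    exact zsmul_mem hv _

theorem forward (hgw : IsGenWeightModule K n M) (hfin : Module.Finite (In K n) M) :
    ((∃ L : Finset (Fin n → K), ∀ mu ∈ supp K n M, ∃ lam ∈ L, mu ∈ orbitOf K n lam) ∧
       (∃ b : ℕ, ∀ lam : Fin n → K,
          Module.rank K (genWeightSpace K n M lam) ≤ (b : Cardinal))) := by
  classical
  set X : Set M := {m | ∃ lam, m ∈ genWeightSpace K n M lam} with hX
  have hspan : Submodule.span (In K n) X = ⊤ := by
    rw [eq_top_iff]
    have h1 : (⨆ mu : Fin n → K, genWeightSpace K n M mu)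
        ≤ (Submodule.span (In K n) X).restrictScalars K :=
      iSup_le fun mu m hm => Submodule.subset_span ⟨mu, hm⟩
    rw [iSup_gw hgw] at h1
    exact fun m _ => h1 (Submodule.mem_top)
  have hfg : (Submodule.span (In K n) X).FG := by rw [hspan]; exact hfin.fg_top
  obtain ⟨G, hGX, hG⟩ := Submodule.fg_span_iff_fg_span_finset_subset X |>.1 hfg
  rw [hspan] at hG
  have hGX' : ∀ g : G, ∃ lam, (g : M) ∈ genWeightSpace K n M lam := fun g => hGX g.2
  choose lam hlam using hGX'
  choose V hVfin hgV hVle hVH hVp using fun g => exists_V (hlam g)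
  have htop : (⨆ x : G × (Fin n → ℤ),
      (V x.1).map (Algebra.lsmul K K M (tEl K n x.2))) = ⊤ := by
    set W := ⨆ x : G × (Fin n → ℤ), (V x.1).map (Algebra.lsmul K K M (tEl K n x.2)) with hW
    let W' : Submodule (In K n) M :=
      { W with smul_mem' := fun a w hw => tV_stable V hVH hVp a w hw }
    have h1 : Submodule.span (In K n) (G : Set M) ≤ W' := by
      rw [Submodule.span_le]
      intro g hg
      have h2 : tEl K n 0 • g ∈ W :=
        Submodule.mem_iSup_of_mem ((⟨g, hg⟩ : G), 0)
          (Submodule.mem_map_of_mem (hgV ⟨g, hg⟩))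
      rw [t_zero, one_smul] at h2
      exact h2
    rw [← hG] at h1
    rw [eq_top_iff]
    exact fun m _ => h1 Submodule.mem_top
  have hcov := gw_le_of_cover hgw _
    (fun x : G × (Fin n → ℤ) => fun j => lam x.1 j + (x.2 j : K)) (by
      intro x
      rw [Submodule.map_le_iff_le_comap]
      intro v hv
      exact gw_t x.2 (hVle x.1 hv)) htop
  refine ⟨⟨Finset.univ.image lam, ?_⟩, Module.finrank K (∀ g : G, V g), ?_⟩
  · intro mu hmu
    by_contra! hcon
    apply hmu
    rw [eq_bot_iff]
    refine (hcov mu).trans (iSup₂_le ?_)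
    rintro ⟨g, z⟩ rfl
    exfalso
    exact hcon (lam g) (Finset.mem_image_of_mem _ (Finset.mem_univ g))
      (fun i => ⟨z i, by simp⟩)
  · intro mu
    have hz : ∀ g : G, ∃ z : Fin n → ℤ, ∀ z', (fun j => lam g j + (z' j : K)) = mu → z' = z := by
      intro g
      by_cases h : ∃ z : Fin n → ℤ, (fun j => lam g j + (z j : K)) = mu
      · obtain ⟨z, hz⟩ := h
        refine ⟨z, fun z' hz' => ?_⟩
        funext j
        have h1 := congrFun (hz'.trans hz.symm) j
        simpa using h1
      · exact ⟨0, fun z' hz' => (h ⟨z', hz'⟩).elim⟩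
    choose z hz using hz
    let φ : (∀ g : G, V g) →ₗ[K] M := ∑ g : G,
      (Algebra.lsmul K K M (tEl K n (z g))) ∘ₗ (V g).subtype ∘ₗ LinearMap.proj g
    have hle : genWeightSpace K n M mu ≤ LinearMap.range φ := by
      refine (hcov mu).trans (iSup₂_le ?_)
      rintro ⟨g, z'⟩ hz'
      have := hz g z' hz'
      subst this
      rw [Submodule.map_le_iff_le_comap]
      intro v hv
      refine ⟨Pi.single g ⟨v, hv⟩, ?_⟩
      simp only [φ, LinearMap.sum_apply, LinearMap.comp_apply, LinearMap.proj_apply]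
      rw [Finset.sum_eq_single g]
      · simp
      · intro b _ hb
        simp [Pi.single_eq_of_ne hb]
      · simp
    calc Module.rank K (genWeightSpace K n M mu) ≤ Module.rank K (LinearMap.range φ) :=
          Submodule.rank_mono hle
      _ ≤ Module.rank K (∀ g : G, V g) := rank_range_le φ
      _ = _ := (Module.finrank_eq_rank K _).symm

/-- normalisation of a weight: integral coordinates become `1`. -/
noncomputable def nrm (lam : Fin n → K) : Fin n → K := by
  classical
  exact fun i => if ∃ z : ℤ, lam i = (z : K) then 1 else lam i

lemma reach (N : Submodule K M) (hd : ∀ a : In K n, ∀ m ∈ N, a • m ∈ N) (lam : Fin n → K)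
    (hlam : ∀ i (k : ℕ), lam i + k ≠ 0) (h0 : genWeightSpace K n M lam ≤ N)
    (s : Finset (Fin n)) : ∀ z : Fin n → ℤ, (∀ i ∉ s, z i = 0) →
      genWeightSpace K n M (fun j => lam j + (z j : K)) ≤ N := by
  classical
  have down : ∀ (mu : Fin n → K) i, genWeightSpace K n M mu ≤ N →
      genWeightSpace K n M (Function.update mu i (mu i - 1)) ≤ N := by
    intro mu i h m hm
    have h1 := gw_i i hm
    rw [Function.update_self, Function.update_idem, sub_add_cancel,
      Function.update_eq_self] at h1
    have h2 := hd (dEl K n i) _ (h h1)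
    rwa [← mul_smul, d_int, one_smul] at h2
  have up : ∀ (mu : Fin n → K) i, mu i ≠ 0 → genWeightSpace K n M mu ≤ N →
      genWeightSpace K n M (Function.update mu i (mu i + 1)) ≤ N := by
    intro mu i hi h m hm
    have h1 := gw_d i hm
    rw [Function.update_self, Function.update_idem, add_sub_cancel_right,
      Function.update_eq_self] at h1
    have h2 := hd (intEl K n i) _ (h h1)
    rwa [int_d_smul i hm (by rw [Function.update_self]; simpa using hi)] at h2
  induction s using Finset.induction_on with
  | empty =>
    intro z hz
    have : (fun j => lam j + (z j : K)) = lam := by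
      funext j; simp [hz j (by simp)]
    rw [this]; exact h0
  | insert i s hi ih =>
    intro z hz
    have key : ∀ k : ℤ, genWeightSpace K n M
        (fun j => lam j + ((Function.update z i k : Fin n → ℤ) j : K)) ≤ N := by
      have hup : ∀ k l : ℤ, ∀ d : K, (l : K) = k + d →
          Function.update (fun j => lam j + ((Function.update z i k : Fin n → ℤ) j : K)) i
            ((lam i + ((Function.update z i k : Fin n → ℤ) i : K)) + d)
          = (fun j => lam j + ((Function.update z i l : Fin n → ℤ) j : K)) := by
        intro k l d hkl
        funext j
        rcases eq_or_ne j i with rfl | hj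
        · simp [hkl, add_assoc]
        · simp [hj]
      intro k
      induction k using Int.induction_on with
      | zero =>
        apply ih
        intro j hj
        rcases eq_or_ne j i with rfl | hji
        · simp
        · rw [Function.update_of_ne hji]; exact hz j (by simp [hji, hj])
      | succ k ihk =>
        have := up _ i (by simpa using hlam i k) ihk
        rwa [hup (k : ℤ) ((k : ℤ) + 1) 1 (by push_cast; ring)] at this
      | pred k ihk =>
        have := down _ i ihk
        simp only [sub_eq_add_neg] at this
        rwa [hup (-(k : ℤ)) (-(k : ℤ) - 1) (-1) (by push_cast; ring)] at this
    have := key (z i)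
    rwa [Function.update_eq_self] at this

theorem backward (hgw : IsGenWeightModule K n M)
    (L : Finset (Fin n → K)) (hL : ∀ mu ∈ supp K n M, ∃ lam ∈ L, mu ∈ orbitOf K n lam)
    (b : ℕ) (hb : ∀ lam : Fin n → K,
          Module.rank K (genWeightSpace K n M lam) ≤ (b : Cardinal)) :
    Module.Finite (In K n) M := by
  classical
  have hfd : ∀ lam : Fin n → K, (genWeightSpace K n M lam).FG := by
    intro lam
    have : Module.Finite K (genWeightSpace K n M lam) :=
      Module.rank_lt_aleph0_iff.1 ((hb lam).trans_lt (Cardinal.natCast_lt_aleph0))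
    exact Module.Finite.iff_fg.1 this
  choose S hS using hfd
  let T : Finset M := L.biUnion (fun lam => S (nrm lam))
  refine ⟨⟨T, ?_⟩⟩
  set N := Submodule.span (In K n) (T : Set M) with hN
  have hle : ∀ mu, genWeightSpace K n M mu ≤ N.restrictScalars K := by
    intro mu
    by_cases hmu : mu ∈ supp K n M
    · obtain ⟨lam, hl, hml⟩ := hL mu hmu
      have hz : ∀ i, ∃ z : ℤ, mu i = nrm lam i + z := by
        intro i
        obtain ⟨z, hz⟩ := hml i
        by_cases h : ∃ z : ℤ, lam i = (z : K)
        · obtain ⟨y, hy⟩ := h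
          refine ⟨z + y - 1, ?_⟩
          have : nrm lam i = 1 := if_pos ⟨y, hy⟩
          rw [this]; push_cast
          linear_combination hz + hy
        · refine ⟨z, ?_⟩
          have : nrm lam i = lam i := if_neg h
          rw [this]; linear_combination hz
      choose z hz using hz
      have hr := reach (M := M) (N.restrictScalars K) (fun a m hm => N.smul_mem a hm) (nrm lam) ?_ ?_
        Finset.univ z (by simp)
      · have : mu = (fun j => nrm lam j + (z j : K)) := funext hz
        rw [this]; exact hr
      · intro i k h0
        by_cases h : ∃ z : ℤ, lam i = (z : K)
        · have : nrm lam i = 1 := if_pos h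
          rw [this, add_comm] at h0
          exact Nat.cast_add_one_ne_zero k h0
        · have : nrm lam i = lam i := if_neg h
          rw [this] at h0
          exact h ⟨-(k : ℤ), by push_cast; linear_combination h0⟩
      · rw [← hS (nrm lam), Submodule.span_le]
        intro m hm
        exact Submodule.subset_span (Finset.mem_coe.2 (Finset.mem_biUnion.2 ⟨lam, hl, hm⟩))
    · have : genWeightSpace K n M mu = ⊥ := by
        by_contra h; exact hmu h
      rw [this]; exact bot_le
  have h1 := iSup_le hle
  rw [iSup_gw hgw] at h1
  rw [eq_top_iff]
  exact fun m _ => h1 Submodule.mem_top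

end Aux2

/-- a generalized weight `𝕀_n`-module is finitely generated iff its support
meets only finitely many `ℤ^n`-orbits and the dimensions of its generalized weight spaces are
uniformly bounded. -/
theorem statement17 (K : Type*) [Field K] [CharZero K] (n : ℕ)
    (M : Type*) [AddCommGroup M] [Module K M] [Module (In K n) M] [IsScalarTower K (In K n) M] (hgw : IsGenWeightModule K n M) :
    Module.Finite (In K n) M ↔
      ((∃ L : Finset (Fin n → K), ∀ mu ∈ supp K n M, ∃ lam ∈ L, mu ∈ orbitOf K n lam) ∧
       (∃ b : ℕ, ∀ lam : Fin n → K,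
          Module.rank K (genWeightSpace K n M lam) ≤ (b : Cardinal))) := by
  constructor
  · exact forward hgw
  · rintro ⟨⟨L, hL⟩, b, hb⟩
    exact backward hgw L hL b hb

end IDO
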